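/- Let I ⊂ ℝ be a compact interval, φ : I → (0,∞) smooth, ρ̄ ∈ I, Γ(r) = ∫_{ρ̄}^r ds/φ(s), J = Γ(I), and ψ = φ ∘ Γ⁻¹ : J → (0,∞). Then there exist constants λ₀ > 0 and η > 0 depending only on I and φ such that the following holds: for every δ ∈ (0,1), every λ̄ ∈ (0, λ₀], every T > 0, and every smooth function γ : ℝ × [0,T] → J that is 2π-periodic in its first variable and solves the transformed flow equation, if |γ(y,0) − γ(x,0)| ≤ 2λ̄·(√(δ + d(x,y)) − √δ) for all x, y ∈ ℝ, then |γ(y,t) − γ(x,t)| ≤ 2λ̄·(√(δ + d(x,y)) − √δ)·e^{−ηt} for all x, y ∈ ℝ and all t ∈ [0,T]. -/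

import Mathlib

open Real Set Filter

/-- The distance on the circle `ℝ / 2πℤ`: `d(x,y) = min_{j ∈ ℤ} |x - y + 2πj|`. -/
noncomputable def circleDist (x y : ℝ) : ℝ := ⨅ j : ℤ, |x - y + 2 * π * j|

/-- The optimal modulus of continuity of a `2π`-periodic function `f : ℝ → ℝ`:
`ω_f(θ) = sup { |f y - f x| : d(x,y) = θ }`. -/
noncomputable def modCont (f : ℝ → ℝ) (θ : ℝ) : ℝ :=
  sSup {v : ℝ | ∃ x y : ℝ, circleDist x y = θ ∧ v = |f y - f x|}

/-- `ρ` solves the one-dimensional (`n = 1`) Guan–Li flow equation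
`∂ₜρ = ∂ₓ(∂ₓρ / √(φ(ρ)² + (∂ₓρ)²)) + (φ'(ρ)/φ(ρ)) (∂ₓρ)² / √(φ(ρ)² + (∂ₓρ)²)`
at the point `(x, t)`. -/
def SolvesGuanLi (φ : ℝ → ℝ) (ρ : ℝ → ℝ → ℝ) (x t : ℝ) : Prop :=
  deriv (fun s => ρ x s) t =
    deriv (fun y => deriv (fun z => ρ z t) y /
        Real.sqrt ((φ (ρ y t)) ^ 2 + (deriv (fun z => ρ z t) y) ^ 2)) x
    + (deriv φ (ρ x t) / φ (ρ x t)) * (deriv (fun z => ρ z t) x) ^ 2 /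
        Real.sqrt ((φ (ρ x t)) ^ 2 + (deriv (fun z => ρ z t) x) ^ 2)

/-- `γ` solves the transformed flow equation
`∂ₜγ = (1/ψ(γ)) ∂²_θγ / (1 + (∂_θγ)²)^{3/2} + (ψ'(γ)/ψ(γ)²) (∂_θγ)² / √(1 + (∂_θγ)²)`
at the point `(θ, t)`. -/
def SolvesTrans (ψ : ℝ → ℝ) (γ : ℝ → ℝ → ℝ) (θ t : ℝ) : Prop :=
  deriv (fun s => γ θ s) t =
    (1 / ψ (γ θ t)) *
        (deriv (deriv (fun z => γ z t)) θ / (1 + (deriv (fun z => γ z t) θ) ^ 2) ^ ((3:ℝ)/2))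
    + (deriv ψ (γ θ t) / (ψ (γ θ t)) ^ 2) *
        ((deriv (fun z => γ z t) θ) ^ 2 / Real.sqrt (1 + (deriv (fun z => γ z t) θ) ^ 2))

/-- `ζ` is a (pointwise) subsolution of the transformed flow equation at `(θ, t)`. -/
def SubSolTrans (ψ : ℝ → ℝ) (ζ : ℝ → ℝ → ℝ) (θ t : ℝ) : Prop :=
  deriv (fun s => ζ θ s) t ≤
    (1 / ψ (ζ θ t)) *
        (deriv (deriv (fun z => ζ z t)) θ / (1 + (deriv (fun z => ζ z t) θ) ^ 2) ^ ((3:ℝ)/2))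
    + (deriv ψ (ζ θ t) / (ψ (ζ θ t)) ^ 2) *
        ((deriv (fun z => ζ z t) θ) ^ 2 / Real.sqrt (1 + (deriv (fun z => ζ z t) θ) ^ 2))

/-- The second derivative of a real function is nonpositive at a local maximum. -/
lemma IsLocalMax.deriv_deriv_nonpos {f : ℝ → ℝ} {s : ℝ} (h : IsLocalMax f s)
    (hc : ContinuousAt f s) : deriv (deriv f) s ≤ 0 := by
  by_contra! hpos
  have hmin := isLocalMin_of_deriv_deriv_pos hpos h.deriv_eq_zero hc
  have hconst : f =ᶠ[nhds s] fun _ => f s := by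
    filter_upwards [h, hmin] with z h₁ h₂ using le_antisymm h₁ h₂
  rw [hconst.deriv.deriv_eq] at hpos
  simp at hpos

/-- The derivative is nonnegative at a point that dominates all points of an interval on its
left. -/
lemma HasDerivAt.nonneg_of_forall_left_le {F : ℝ → ℝ} {F' a t : ℝ} (hF : HasDerivAt F F' t)
    (hat : a < t) (hmax : ∀ s ∈ Icc a t, F s ≤ F t) : 0 ≤ F' := by
  have hs := (hasDerivAt_iff_tendsto_slope_left_right.1 hF).1
  refine ge_of_tendsto hs ?_
  filter_upwards [Ioo_mem_nhdsLT hat] with s hs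
  rw [slope_def_field]
  exact div_nonneg_of_nonpos (by linarith [hmax s ⟨hs.1.le, hs.2.le⟩]) (by linarith [hs.2])

/-- The first and second order conditions at a global maximum of `g y - g x - S (y - x)`. -/
lemma doubling_max_conditions {g S S₁ : ℝ → ℝ} {S₂ x y : ℝ} (hg : ContDiff ℝ 2 g)
    (hS : ∀ᶠ z in nhds (y - x), HasDerivAt S (S₁ z) z) (hS₁ : HasDerivAt S₁ S₂ (y - x))
    (hmax : ∀ x' y', g y' - g x' - S (y' - x') ≤ g y - g x - S (y - x)) :
    deriv g y = S₁ (y - x) ∧ deriv g x = S₁ (y - x) ∧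
      ∀ p q : ℝ, q ^ 2 * deriv (deriv g) y - p ^ 2 * deriv (deriv g) x ≤ (p + q) ^ 2 * S₂ := by
  have hgd : ∀ z, HasDerivAt g (deriv g z) z := fun z =>
    (hg.differentiable (by norm_num)).differentiableAt.hasDerivAt
  have hg1 : ContDiff ℝ 1 (deriv g) := by
    have : ContDiff ℝ (1 + 1) g := by simpa [one_add_one_eq_two] using hg
    exact (contDiff_succ_iff_deriv.1 this).2.2
  have hgdd : ∀ z, HasDerivAt (deriv g) (deriv (deriv g) z) z := fun z =>
    (hg1.differentiable (by norm_num)).differentiableAt.hasDerivAt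
  have key : ∀ p q : ℝ, q * deriv g y + p * deriv g x - (p + q) * S₁ (y - x) = 0 ∧
      q ^ 2 * deriv (deriv g) y - p ^ 2 * deriv (deriv g) x ≤ (p + q) ^ 2 * S₂ := by
    intro p q
    set f : ℝ → ℝ := fun s => g (y + q * s) - g (x - p * s) - S (y - x + (p + q) * s) with hf
    set f₁ : ℝ → ℝ := fun s => q * deriv g (y + q * s) + p * deriv g (x - p * s)
      - (p + q) * S₁ (y - x + (p + q) * s) with hf₁
    have hl : ∀ c r s : ℝ, HasDerivAt (fun s : ℝ => c + r * s) r s := fun c r s => by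
      simpa using ((hasDerivAt_id s).const_mul r).const_add c
    have hl' : ∀ c r s : ℝ, HasDerivAt (fun s : ℝ => c - r * s) (-r) s := fun c r s => by
      simpa using ((hasDerivAt_id s).const_mul r).const_sub c
    have hfmax : IsLocalMax f 0 := by
      refine Eventually.of_forall fun s => ?_
      have := hmax (x - p * s) (y + q * s)
      have e : y + q * s - (x - p * s) = y - x + (p + q) * s := by ring
      rw [e] at this
      simpa [hf] using this
    have hev : ∀ᶠ s in nhds (0 : ℝ), HasDerivAt f (f₁ s) s := by
      have hc : Tendsto (fun s : ℝ => y - x + (p + q) * s) (nhds 0) (nhds (y - x)) := by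
        have : Continuous (fun s : ℝ => y - x + (p + q) * s) := by fun_prop
        simpa using this.tendsto 0
      filter_upwards [hc.eventually hS] with s hs
      have h₁ := (hgd (y + q * s)).comp s (hl y q s)
      have h₂ := (hgd (x - p * s)).comp s (hl' x p s)
      have h₃ := hs.comp s (hl (y - x) (p + q) s)
      exact ((h₁.sub h₂).sub h₃).congr_deriv (by simp only [hf₁]; ring)
    have hd0 : HasDerivAt f₁ (q ^ 2 * deriv (deriv g) y - p ^ 2 * deriv (deriv g) x
        - (p + q) ^ 2 * S₂) 0 := by
      have e₁ : HasDerivAt (deriv g) (deriv (deriv g) y) (y + q * 0) := by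
        rw [mul_zero, add_zero]; exact hgdd y
      have e₂ : HasDerivAt (deriv g) (deriv (deriv g) x) (x - p * 0) := by
        rw [mul_zero, sub_zero]; exact hgdd x
      have e₃ : HasDerivAt S₁ S₂ (y - x + (p + q) * 0) := by
        rw [mul_zero, add_zero]; exact hS₁
      have h₁ := (e₁.comp 0 (hl y q 0)).const_mul q
      have h₂ := (e₂.comp 0 (hl' x p 0)).const_mul p
      have h₃ := (e₃.comp 0 (hl (y - x) (p + q) 0)).const_mul (p + q)
      exact ((h₁.add h₂).sub h₃).congr_deriv (by ring)
    have hf0 := hev.self_of_nhds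
    have e1 := hfmax.hasDerivAt_eq_zero hf0
    have e2 := hfmax.deriv_deriv_nonpos hf0.continuousAt
    have hdf : deriv f =ᶠ[nhds 0] f₁ := hev.mono fun s hs => hs.deriv
    rw [hdf.deriv_eq, hd0.deriv] at e2
    refine ⟨by simpa [hf₁] using e1, by linarith⟩
  refine ⟨?_, ?_, fun p q => (key p q).2⟩
  · linarith [(key 0 1).1]
  · linarith [(key 1 0).1]

/-- Every coset of `2πℤ` has an element of least absolute value, which is at most `π`. -/
lemma exists_int_abs_add_two_pi_mul_le (h : ℝ) :
    ∃ j : ℤ, |h + 2 * π * j| ≤ π ∧ ∀ k : ℤ, |h + 2 * π * j| ≤ |h + 2 * π * k| := by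
  have hpi := Real.pi_pos
  have e : ∀ k : ℤ, |h + 2 * π * k| = 2 * π * |h / (2 * π) - ((-k : ℤ) : ℝ)| := fun k => by
    rw [← abs_of_pos (show 0 < 2 * π by positivity), ← abs_mul,
      abs_of_pos (show 0 < 2 * π by positivity)]
    congr 1
    push_cast
    field_simp
    ring
  refine ⟨-round (h / (2 * π)), ?_, fun k => ?_⟩
  · rw [e, neg_neg]
    nlinarith [abs_sub_round (h / (2 * π))]
  · rw [e, e, neg_neg]
    exact mul_le_mul_of_nonneg_left (round_le _ _) (by positivity)

/-- For `Γ' = 1 / φ` and `ψ = φ ∘ Γ⁻¹` the function `ψ' / ψ²` is Lipschitz inside `Γ(I)`. -/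
lemma exists_bounds_comp_inverse_primitive {a b : ℝ} (hab : a ≤ b) {φ : ℝ → ℝ}
    (hφ : ContDiffOn ℝ 2 φ (Icc a b)) (hφpos : ∀ s ∈ Icc a b, 0 < φ s) {rb : ℝ}
    (hrb : rb ∈ Icc a b) {Γ : ℝ → ℝ} (hΓ : ∀ r, Γ r = ∫ s in rb..r, 1 / φ s) :
    Γ '' Icc a b = Icc (Γ a) (Γ b) ∧ ∃ M C : ℝ, 0 < M ∧ 0 ≤ C ∧
      (∀ u ∈ Ioo (Γ a) (Γ b), 0 < (φ ∘ Function.invFunOn Γ (Icc a b)) u ∧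
        (φ ∘ Function.invFunOn Γ (Icc a b)) u ≤ M) ∧
      ∀ u ∈ Ioo (Γ a) (Γ b), ∀ v ∈ Ioo (Γ a) (Γ b),
        |deriv (φ ∘ Function.invFunOn Γ (Icc a b)) u /
            (φ ∘ Function.invFunOn Γ (Icc a b)) u ^ 2
          - deriv (φ ∘ Function.invFunOn Γ (Icc a b)) v /
            (φ ∘ Function.invFunOn Γ (Icc a b)) v ^ 2| ≤ C * |u - v| := by
  rcases eq_or_lt_of_le hab with rfl | hab'
  · exact ⟨by simp, 1, 0, by simp⟩
  obtain ⟨M, hM⟩ := isCompact_Icc.bddAbove_image hφ.continuousOn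
  have hφM : ∀ s ∈ Icc a b, φ s ≤ M := fun s hs => hM ⟨s, hs, rfl⟩
  have hMpos : 0 < M := (hφpos rb hrb).trans_le (hφM rb hrb)
  have hinv : ContinuousOn (fun s => 1 / φ s) (Icc a b) :=
    continuousOn_const.div hφ.continuousOn fun s hs => (hφpos s hs).ne'
  have hΓ' : Γ = fun r => ∫ s in rb..r, 1 / φ s := funext hΓ
  have hΓc : ContinuousOn Γ (Icc a b) := by
    have h := intervalIntegral.continuousOn_primitive_interval' (μ := MeasureTheory.volume)
      (f := fun s => 1 / φ s) (a := rb) (b₁ := a) (b₂ := b)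
      (by apply ContinuousOn.intervalIntegrable; rwa [uIcc_of_le hab])
      (by rwa [uIcc_of_le hab])
    rwa [uIcc_of_le hab, ← hΓ'] at h
  have hΓd : ∀ r ∈ Ioo a b, HasDerivAt Γ (1 / φ r) r := by
    intro r hr
    rw [hΓ']
    have hsub : uIcc rb r ⊆ Icc a b := uIcc_subset_Icc hrb (Ioo_subset_Icc_self hr)
    exact intervalIntegral.integral_hasDerivAt_right
      ((hinv.mono hsub).intervalIntegrable)
      (ContinuousOn.stronglyMeasurableAtFilter isOpen_Ioo (hinv.mono Ioo_subset_Icc_self) r hr)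
      (hinv.continuousAt (Icc_mem_nhds hr.1 hr.2))
  have hgrow : ∀ r ∈ Icc a b, ∀ s ∈ Icc a b, r ≤ s → 1 / M * (s - r) ≤ Γ s - Γ r := by
    refine (convex_Icc a b).mul_sub_le_image_sub_of_le_deriv hΓc ?_ ?_
    · rw [interior_Icc]
      exact fun r hr => (hΓd r hr).differentiableAt.differentiableWithinAt
    · rw [interior_Icc]
      intro r hr
      rw [(hΓd r hr).deriv]
      exact one_div_le_one_div_of_le (hφpos r (Ioo_subset_Icc_self hr))
        (hφM r (Ioo_subset_Icc_self hr))
  have hlip : ∀ r ∈ Icc a b, ∀ s ∈ Icc a b, |r - s| ≤ M * |Γ r - Γ s| := by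
    have aux : ∀ r ∈ Icc a b, ∀ s ∈ Icc a b, r ≤ s → |r - s| ≤ M * |Γ r - Γ s| := by
      intro r hr s hs hrs
      have h := hgrow r hr s hs hrs
      have h' : s - r ≤ M * (Γ s - Γ r) := by
        calc s - r = M * (1 / M * (s - r)) := by field_simp
          _ ≤ _ := mul_le_mul_of_nonneg_left h hMpos.le
      rw [abs_sub_comm r, abs_sub_comm (Γ r), abs_of_nonneg (sub_nonneg.2 hrs)]
      exact h'.trans (mul_le_mul_of_nonneg_left (le_abs_self _) hMpos.le)
    intro r hr s hs
    rcases le_total r s with h | h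
    · exact aux r hr s hs h
    · rw [abs_sub_comm r, abs_sub_comm (Γ r)]
      exact aux s hs r hr h
  have hinj : InjOn Γ (Icc a b) := by
    intro r hr s hs h
    have := hlip r hr s hs
    rw [h, sub_self, abs_zero, mul_zero] at this
    linarith [abs_nonpos_iff.1 this]
  have hmono : MonotoneOn Γ (Icc a b) := by
    intro r hr s hs hrs
    have := hgrow r hr s hs hrs
    have h2 : 0 ≤ 1 / M * (s - r) := mul_nonneg (by positivity) (sub_nonneg.2 hrs)
    linarith
  set G := Function.invFunOn Γ (Icc a b) with hG
  have hleft : ∀ r ∈ Icc a b, G (Γ r) = r := fun r hr => hinj.leftInvOn_invFunOn hr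
  have hsurj : Ioo (Γ a) (Γ b) ⊆ Γ '' Ioo a b := intermediate_value_Ioo hab hΓc
  have hGmem : ∀ u ∈ Ioo (Γ a) (Γ b), G u ∈ Ioo a b ∧ Γ (G u) = u := by
    intro u hu
    obtain ⟨r, hr, rfl⟩ := hsurj hu
    rw [hleft r (Ioo_subset_Icc_self hr)]
    exact ⟨hr, rfl⟩
  have hGlip : ∀ u ∈ Ioo (Γ a) (Γ b), ∀ v ∈ Ioo (Γ a) (Γ b), |G u - G v| ≤ M * |u - v| := by
    intro u hu v hv
    have h := hlip _ (Ioo_subset_Icc_self (hGmem u hu).1) _ (Ioo_subset_Icc_self (hGmem v hv).1)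
    rwa [(hGmem u hu).2, (hGmem v hv).2] at h
  have hGd : ∀ u ∈ Ioo (Γ a) (Γ b), HasDerivAt G (φ (G u)) u := by
    intro u hu
    have hGc : ContinuousAt G u := by
      have : LipschitzOnWith (Real.toNNReal M) G (Ioo (Γ a) (Γ b)) := by
        refine LipschitzOnWith.of_dist_le_mul fun v hv w hw => ?_
        rw [Real.dist_eq, Real.dist_eq, Real.coe_toNNReal _ hMpos.le]
        exact hGlip v hv w hw
      exact this.continuousOn.continuousAt (Ioo_mem_nhds hu.1 hu.2)
    have hpos := hφpos _ (Ioo_subset_Icc_self (hGmem u hu).1)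
    have h := HasDerivAt.of_local_left_inverse hGc (hΓd _ (hGmem u hu).1)
      (one_div_pos.2 hpos).ne'
      (by filter_upwards [Ioo_mem_nhds hu.1 hu.2] with v hv using (hGmem v hv).2)
    simpa using h
  set D : ℝ → ℝ := fun r => derivWithin φ (Icc a b) r / φ r with hD
  have hDC : ContDiffOn ℝ 1 D (Icc a b) :=
    (hφ.derivWithin (uniqueDiffOn_Icc hab') (by norm_num)).div (hφ.of_le (by norm_num))
      fun r hr => (hφpos r hr).ne'
  obtain ⟨K, hK⟩ := hDC.exists_lipschitzOnWith (by norm_num) (convex_Icc a b) isCompact_Icc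
  have hquot : ∀ u ∈ Ioo (Γ a) (Γ b), deriv (φ ∘ G) u / (φ ∘ G) u ^ 2 = D (G u) := by
    intro u hu
    have hmem := (hGmem u hu).1
    have hφd : HasDerivAt φ (derivWithin φ (Icc a b) (G u)) (G u) :=
      ((hφ.differentiableOn (by norm_num)) _
        (Ioo_subset_Icc_self hmem)).hasDerivWithinAt.hasDerivAt (Icc_mem_nhds hmem.1 hmem.2)
    rw [(hφd.comp u (hGd u hu)).deriv, hD]
    have := (hφpos _ (Ioo_subset_Icc_self hmem)).ne'
    simp only [Function.comp_apply]
    field_simp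
  refine ⟨?_, M, K * M, hMpos, by positivity, ?_, ?_⟩
  · refine Subset.antisymm ?_ (intermediate_value_Icc hab hΓc)
    rintro _ ⟨r, hr, rfl⟩
    exact ⟨hmono (left_mem_Icc.2 hab) hr hr.1, hmono hr (right_mem_Icc.2 hab) hr.2⟩
  · intro u hu
    have := Ioo_subset_Icc_self (hGmem u hu).1
    exact ⟨hφpos _ this, hφM _ this⟩
  · intro u hu v hv
    rw [hquot u hu, hquot v hv]
    have h := hK.dist_le_mul _ (Ioo_subset_Icc_self (hGmem u hu).1) _
      (Ioo_subset_Icc_self (hGmem v hv).1)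
    rw [Real.dist_eq, Real.dist_eq] at h
    refine h.trans ?_
    rw [mul_assoc]
    exact mul_le_mul_of_nonneg_left (hGlip u hu v hv) K.2

/-- The second derivative of the square root modulus dominates the gradient term and the decay
rate, up to a multiple of the excess `w`. -/
lemma sqrt_modulus_strict_ineq {M C L r v η σ w B : ℝ} (hM : 0 < M) (hC : 0 ≤ C) (hL : 0 < L)
    (hr : 0 < r) (hv : 0 < v) (hrv : v ^ 2 = r ^ 2 + L ^ 2) (hr5 : r ^ 2 ≤ 5) (hL1 : L ≤ 1)
    (hCL : 18 * C * M * L ^ 2 ≤ 1) (hη : 0 ≤ η) (hηM : 108 * M * η ≤ 1) (hσ : σ ≤ 2 * L * r)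
    (hw : 0 ≤ w) (hB : L / r ≤ B) :
    4 / M * (-L / (2 * r ^ 3)) / (v / r) ^ 3 + C * (w + σ) * ((L / r) ^ 2 / (v / r)) + η * σ
      < C * B * w := by
  have hrlev : r ≤ v := by nlinarith [sq_nonneg L]
  have hLlev : L ≤ v := by nlinarith [sq_nonneg r]
  have hv6 : v ^ 2 ≤ 6 := by nlinarith
  have hgrad : (L / r) ^ 2 / (v / r) ≤ L / r := by
    rw [show (L / r) ^ 2 / (v / r) = L / r * (L / v) by field_simp]
    exact mul_le_of_le_one_right (by positivity) ((div_le_one hv).2 hLlev)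
  have h₁ : C * w * ((L / r) ^ 2 / (v / r)) ≤ C * B * w := by
    calc C * w * ((L / r) ^ 2 / (v / r)) ≤ C * w * B :=
          mul_le_mul_of_nonneg_left (hgrad.trans hB) (by positivity)
      _ = C * B * w := by ring
  have h₂ : C * σ * ((L / r) ^ 2 / (v / r)) ≤ 2 * C * L ^ 3 / v := by
    calc C * σ * ((L / r) ^ 2 / (v / r)) ≤ C * (2 * L * r) * ((L / r) ^ 2 / (v / r)) := by gcongr
      _ = 2 * C * L ^ 3 / v := by field_simp
  have h₃ : η * σ ≤ 2 * η * L * v := by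
    calc η * σ ≤ η * (2 * L * r) := by gcongr
      _ ≤ η * (2 * L * v) := by gcongr
      _ = 2 * η * L * v := by ring
  have h₄ : 4 / M * (-L / (2 * r ^ 3)) / (v / r) ^ 3 = -(2 * L / (M * v ^ 3)) := by
    field_simp; ring
  have hv4 : v ^ 4 ≤ 36 := by nlinarith
  have h₅ : 2 * C * L ^ 3 / v + 2 * η * L * v < 2 * L / (M * v ^ 3) := by
    have e : 2 * C * L ^ 3 / v + 2 * η * L * v
        = 2 * L * (C * M * L ^ 2 * v ^ 2 + M * η * v ^ 4) / (M * v ^ 3) := by field_simp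
    rw [e]
    refine div_lt_div_of_pos_right ?_ (by positivity)
    have a₁ : C * M * L ^ 2 * v ^ 2 ≤ 1 / 3 := by
      have : C * M * L ^ 2 * v ^ 2 ≤ C * M * L ^ 2 * 6 := by gcongr
      linarith
    have a₂ : M * η * v ^ 4 ≤ 1 / 3 := by
      have : M * η * v ^ 4 ≤ M * η * 36 := by gcongr
      linarith
    nlinarith
  have e : C * (w + σ) * ((L / r) ^ 2 / (v / r))
      = C * w * ((L / r) ^ 2 / (v / r)) + C * σ * ((L / r) ^ 2 / (v / r)) := by ring
  rw [e, h₄]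
  linarith

/-- First and second derivatives of `z ↦ 2L(√(δ + |z|) - √δ)` away from the origin. -/
lemma exists_derivatives_sqrt_modulus {δ L h : ℝ} (hδ : 0 < δ) (hh : h ≠ 0) :
    ∃ S₁ : ℝ → ℝ, S₁ h ^ 2 = (L / √(δ + |h|)) ^ 2 ∧
      (∀ᶠ z in nhds h, HasDerivAt (fun z => 2 * L * (√(δ + |z|) - √δ)) (S₁ z) z) ∧
      HasDerivAt S₁ (-L / (2 * √(δ + |h|) ^ 3)) h := by
  obtain ⟨τ, hτ₁, hτh⟩ : ∃ τ : ℝ, |τ| = 1 ∧ 0 < τ * h := by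
    rcases hh.lt_or_gt with h' | h'
    · exact ⟨-1, by norm_num, by linarith⟩
    · exact ⟨1, by norm_num, by linarith⟩
  have hτ : τ ^ 2 = 1 := by rw [← sq_abs, hτ₁, one_pow]
  have habs : ∀ z, 0 < τ * z → |z| = τ * z := by
    intro z hz
    rw [← abs_of_pos hz, abs_mul, hτ₁, one_mul]
  have hev : ∀ᶠ z in nhds h, 0 < τ * z :=
    (continuous_const.mul continuous_id).continuousAt.eventually (lt_mem_nhds hτh)
  have hlin : ∀ z, HasDerivAt (fun z : ℝ => δ + τ * z) τ z := fun z => by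
    simpa using ((hasDerivAt_id z).const_mul τ).const_add δ
  have hsqrt : ∀ z, 0 < τ * z →
      HasDerivAt (fun z : ℝ => √(δ + τ * z)) (τ / (2 * √(δ + τ * z))) z := fun z hz =>
    (hlin z).sqrt (by positivity)
  refine ⟨fun z => L * τ / √(δ + τ * z), ?_, ?_, ?_⟩
  · rw [habs h hτh]
    simp only [div_pow, mul_pow, hτ, mul_one]
  · filter_upwards [hev.eventually_nhds] with z hz
    have hz0 := hz.self_of_nhds
    have h₁ := ((hsqrt z hz0).sub_const √δ).const_mul (2 * L)
    refine (h₁.congr_deriv ?_).congr_of_eventuallyEq ?_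
    · field_simp
    · filter_upwards [hz] with u hu
      rw [habs u hu]
  · have hpos : 0 < √(δ + τ * h) := Real.sqrt_pos.2 (by positivity)
    refine ((hasDerivAt_const h (L * τ)).div (hsqrt h hτh) hpos.ne').congr_deriv ?_
    rw [habs h hτh]
    field_simp
    linear_combination (-L) * hτ

/-- At a spatial maximum of the doubled function the two time derivatives of a solution of the
transformed flow differ by at most the second order term of the modulus plus a gradient term. -/
lemma SolvesTrans.sub_le_of_doubling_max {ψ : ℝ → ℝ} {p q M C : ℝ} (hM : 0 < M)
    (hψ : ∀ u ∈ Ioo p q, 0 < ψ u ∧ ψ u ≤ M)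
    (hlip : ∀ u ∈ Ioo p q, ∀ v ∈ Ioo p q,
      |deriv ψ u / ψ u ^ 2 - deriv ψ v / ψ v ^ 2| ≤ C * |u - v|)
    {γ : ℝ → ℝ → ℝ} {t : ℝ} (hg : ContDiff ℝ 2 (fun z => γ z t))
    (hrange : ∀ x, γ x t ∈ Icc p q) (hsol : ∀ x, SolvesTrans ψ γ x t)
    {L δ : ℝ} (hL : 0 < L) (hδ : 0 < δ) {x y : ℝ} (hxy : y - x ≠ 0) (hlt : γ x t < γ y t)
    (hmax : ∀ x' y', γ y' t - γ x' t - 2 * L * (√(δ + |y' - x'|) - √δ)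
      ≤ γ y t - γ x t - 2 * L * (√(δ + |y - x|) - √δ)) :
    deriv (fun s => γ y s) t - deriv (fun s => γ x s) t ≤
      4 / M * (-L / (2 * √(δ + |y - x|) ^ 3))
          / (√(δ + |y - x| + L ^ 2) / √(δ + |y - x|)) ^ 3
        + C * (γ y t - γ x t) * ((L / √(δ + |y - x|)) ^ 2
          / (√(δ + |y - x| + L ^ 2) / √(δ + |y - x|))) := by
  obtain ⟨S₁, hS₁sq, hS, hS₁⟩ := exists_derivatives_sqrt_modulus (L := L) hδ hxy
  have hR : 0 < δ + |y - x| := by positivity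
  have hr : 0 < √(δ + |y - x|) := Real.sqrt_pos.2 hR
  have hr2 : √(δ + |y - x|) ^ 2 = δ + |y - x| := Real.sq_sqrt hR.le
  have hv : 0 < √(δ + |y - x| + L ^ 2) := Real.sqrt_pos.2 (by positivity)
  have hv2 : √(δ + |y - x| + L ^ 2) ^ 2 = δ + |y - x| + L ^ 2 := Real.sq_sqrt (by positivity)
  obtain ⟨hy, hx, hsec⟩ := doubling_max_conditions hg hS hS₁ hmax
  set r := √(δ + |y - x|) with hrdef
  set v := √(δ + |y - x| + L ^ 2) with hvdef
  have hslope : S₁ (y - x) ≠ 0 := by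
    have : 0 < S₁ (y - x) ^ 2 := by rw [hS₁sq]; positivity
    exact fun h => by simp [h] at this
  have hinterior : ∀ z, deriv (fun z => γ z t) z ≠ 0 → γ z t ∈ Ioo p q := by
    intro z hz
    refine ⟨lt_of_le_of_ne (hrange z).1 fun h => hz ?_,
      lt_of_le_of_ne (hrange z).2 fun h => hz ?_⟩
    · exact IsLocalMin.deriv_eq_zero (Eventually.of_forall fun u => by
        simpa [← h] using (hrange u).1)
    · exact IsLocalMax.deriv_eq_zero (Eventually.of_forall fun u => by
        simpa [h] using (hrange u).2)
  have hyI := hinterior y (by rw [hy]; exact hslope)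
  have hxI := hinterior x (by rw [hx]; exact hslope)
  obtain ⟨hψy, hψyM⟩ := hψ _ hyI
  obtain ⟨hψx, hψxM⟩ := hψ _ hxI
  have hs2 : 1 + S₁ (y - x) ^ 2 = (v / r) ^ 2 := by
    rw [hS₁sq, div_pow, div_pow, hr2, hv2]
    field_simp
  have hs : 0 < v / r := by positivity
  have hs3 : ((v / r) ^ 2) ^ ((3 : ℝ) / 2) = (v / r) ^ 3 := by
    rw [← Real.rpow_natCast (v / r) 2, ← Real.rpow_mul hs.le]
    norm_num
  have ey := hsol y
  have ex := hsol x
  simp only [SolvesTrans] at ey ex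
  rw [hy, hs2, hs3, Real.sqrt_sq hs.le] at ey
  rw [hx, hs2, hs3, Real.sqrt_sq hs.le] at ex
  have hsec' : 1 / ψ (γ y t) * deriv (deriv fun z => γ z t) y
      - 1 / ψ (γ x t) * deriv (deriv fun z => γ z t) x ≤ 4 / M * (-L / (2 * r ^ 3)) := by
    have h := hsec (1 / √(ψ (γ x t))) (1 / √(ψ (γ y t)))
    rw [div_pow, div_pow, Real.sq_sqrt hψy.le, Real.sq_sqrt hψx.le, one_pow] at h
    refine h.trans ?_
    have hinvx : 1 / √M ≤ 1 / √(ψ (γ x t)) :=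
      one_div_le_one_div_of_le (Real.sqrt_pos.2 hψx) (Real.sqrt_le_sqrt hψxM)
    have hinvy : 1 / √M ≤ 1 / √(ψ (γ y t)) :=
      one_div_le_one_div_of_le (Real.sqrt_pos.2 hψy) (Real.sqrt_le_sqrt hψyM)
    have hfour : 4 / M ≤ (1 / √(ψ (γ x t)) + 1 / √(ψ (γ y t))) ^ 2 := by
      have e : 4 / M = (1 / √M + 1 / √M) ^ 2 := by
        rw [← two_mul, mul_pow, div_pow, Real.sq_sqrt hM.le]
        ring
      rw [e]
      gcongr
    refine mul_le_mul_of_nonpos_right hfour ?_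
    rw [neg_div]
    exact neg_nonpos.2 (by positivity)
  have hlip' := (le_abs_self _).trans (hlip _ hyI _ hxI)
  rw [abs_of_pos (sub_pos.2 hlt)] at hlip'
  have hgrad : 0 ≤ S₁ (y - x) ^ 2 / (v / r) := by positivity
  calc deriv (fun s => γ y s) t - deriv (fun s => γ x s) t
      = (1 / ψ (γ y t) * deriv (deriv fun z => γ z t) y
          - 1 / ψ (γ x t) * deriv (deriv fun z => γ z t) x) / (v / r) ^ 3
        + (deriv ψ (γ y t) / ψ (γ y t) ^ 2 - deriv ψ (γ x t) / ψ (γ x t) ^ 2)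
          * (S₁ (y - x) ^ 2 / (v / r)) := by rw [ey, ex]; ring
    _ ≤ 4 / M * (-L / (2 * r ^ 3)) / (v / r) ^ 3
        + C * (γ y t - γ x t) * (S₁ (y - x) ^ 2 / (v / r)) := by
        gcongr
    _ = _ := by rw [hS₁sq]

/-- Translating by multiples of the period, a pair of points can be moved into a compact set
without increasing its distance. -/
lemma exists_translate_pair_mem_Icc {f : ℝ → ℝ} (hf : Function.Periodic f (2 * π)) (x y : ℝ) :
    ∃ x' ∈ Icc 0 (2 * π), ∃ h ∈ Icc (-π) π, f x' = f x ∧ f (x' + h) = f y ∧ |h| ≤ |y - x| := by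
  obtain ⟨j, hjπ, hj⟩ := exists_int_abs_add_two_pi_mul_le (y - x)
  obtain ⟨i, hi, -⟩ := existsUnique_add_zsmul_mem_Ico Real.two_pi_pos x 0
  simp only [zero_add, zsmul_eq_mul] at hi
  refine ⟨x + i * (2 * π), Ico_subset_Icc_self hi, y - x + 2 * π * j, abs_le.1 hjπ,
    hf.int_mul i x, ?_, by simpa using hj 0⟩
  rw [show x + i * (2 * π) + (y - x + 2 * π * j) = y + ((i + j : ℤ) : ℝ) * (2 * π) by
    push_cast; ring]
  exact hf.int_mul (i + j) y

/-- The modulus estimate, in terms of the distance in `ℝ`, before the final time. -/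
lemma sub_le_sqrt_modulus_mul_exp {ψ : ℝ → ℝ} {p q M C : ℝ} (hM : 0 < M) (hC : 0 ≤ C)
    (hψ : ∀ u ∈ Ioo p q, 0 < ψ u ∧ ψ u ≤ M)
    (hlip : ∀ u ∈ Ioo p q, ∀ v ∈ Ioo p q,
      |deriv ψ u / ψ u ^ 2 - deriv ψ v / ψ v ^ 2| ≤ C * |u - v|)
    {δ lam η T : ℝ} (hδ : δ ∈ Ioo (0 : ℝ) 1) (hlam : 0 < lam) (hlam1 : lam ≤ 1)
    (hClam : 18 * C * M * lam ^ 2 ≤ 1) (hη : 0 ≤ η) (hηM : 108 * M * η ≤ 1)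
    {γ : ℝ → ℝ → ℝ} (hγ : ContDiffOn ℝ 2 (Function.uncurry γ) (univ ×ˢ Icc 0 T))
    (hper : ∀ x t, γ (x + 2 * π) t = γ x t) (hrange : ∀ x t, t ∈ Icc 0 T → γ x t ∈ Icc p q)
    (hsol : ∀ x t, t ∈ Ioo 0 T → SolvesTrans ψ γ x t)
    (hinit : ∀ x y, γ y 0 - γ x 0 ≤ 2 * lam * (√(δ + |y - x|) - √δ))
    {t : ℝ} (ht : t ∈ Ico 0 T) (x y : ℝ) :
    γ y t - γ x t ≤ 2 * (lam * exp (-η * t)) * (√(δ + |y - x|) - √δ) := by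
  by_contra! hcon
  set W : ℝ → ℝ → ℝ → ℝ := fun x y s =>
    γ y s - γ x s - 2 * (lam * exp (-η * s)) * (√(δ + |y - x|) - √δ) with hW
  set k : ℝ := C * (lam / √δ) with hk
  have hWle : ∀ (s x y : ℝ), ∃ x' ∈ Icc 0 (2 * π), ∃ h ∈ Icc (-π) π,
      W x y s ≤ W x' (x' + h) s := by
    intro s x y
    obtain ⟨x', hx', h, hh, e₁, e₂, hle⟩ :=
      exists_translate_pair_mem_Icc (f := fun z => γ z s) (fun z => hper z s) x y
    refine ⟨x', hx', h, hh, ?_⟩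
    simp only [hW]
    rw [e₁, e₂, add_sub_cancel_left]
    gcongr
  have hcont : ContinuousOn
      (fun z : ℝ × ℝ × ℝ => exp (-k * z.2.2) * W z.1 (z.1 + z.2.1) z.2.2)
      (Icc 0 (2 * π) ×ˢ Icc (-π) π ×ˢ Icc 0 t) := by
    have h₁ : ContinuousOn (fun z : ℝ × ℝ × ℝ => γ (z.1 + z.2.1) z.2.2)
        (Icc 0 (2 * π) ×ˢ Icc (-π) π ×ˢ Icc 0 t) :=
      hγ.continuousOn.comp (f := fun z : ℝ × ℝ × ℝ => (z.1 + z.2.1, z.2.2)) (by fun_prop)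
        fun z hz => ⟨mem_univ _, hz.2.2.1, hz.2.2.2.trans ht.2.le⟩
    have h₂ : ContinuousOn (fun z : ℝ × ℝ × ℝ => γ z.1 z.2.2)
        (Icc 0 (2 * π) ×ˢ Icc (-π) π ×ˢ Icc 0 t) :=
      hγ.continuousOn.comp (f := fun z : ℝ × ℝ × ℝ => (z.1, z.2.2)) (by fun_prop)
        fun z hz => ⟨mem_univ _, hz.2.2.1, hz.2.2.2.trans ht.2.le⟩
    exact (Continuous.continuousOn (by fun_prop)).mul
      ((h₁.sub h₂).sub (Continuous.continuousOn (by fun_prop)))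
  obtain ⟨x₀, hx₀, h₀, hh₀, hle₀⟩ := hWle t x y
  obtain ⟨⟨x₁, h, t₁⟩, ⟨-, hh, ht₁⟩, hmaxOn⟩ :=
    (isCompact_Icc.prod (isCompact_Icc.prod isCompact_Icc)).exists_isMaxOn
      ⟨(x₀, h₀, t), hx₀, hh₀, right_mem_Icc.2 ht.1⟩ hcont
  simp only at hh ht₁
  have hmax : ∀ s ∈ Icc 0 t, ∀ x y, exp (-k * s) * W x y s
      ≤ exp (-k * t₁) * W x₁ (x₁ + h) t₁ := by
    intro s hs x y
    obtain ⟨x', hx', h', hh', hle⟩ := hWle s x y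
    exact (mul_le_mul_of_nonneg_left hle (exp_pos _).le).trans
      (hmaxOn (a := (x', h', s)) ⟨hx', hh', hs⟩)
  clear hmaxOn hle₀ hx₀ hh₀ hcont
  set y₁ := x₁ + h with hy₁
  have hhy : y₁ - x₁ = h := by simp [hy₁]
  have hWpos : 0 < W x₁ y₁ t₁ := by
    have h₁ := hmax t (right_mem_Icc.2 ht.1) x y
    have h₂ : 0 < exp (-k * t) * W x y t := mul_pos (exp_pos _) (sub_pos.2 hcon)
    exact pos_of_mul_pos_right (h₂.trans_le h₁) (exp_pos _).le
  have hne : y₁ - x₁ ≠ 0 := by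
    intro h0
    rw [sub_eq_zero] at h0
    simp [hW, h0] at hWpos
  have ht₁pos : 0 < t₁ := by
    refine lt_of_le_of_ne ht₁.1 fun h0 => ?_
    have := hinit x₁ y₁
    simp only [hW, ← h0] at hWpos
    norm_num at hWpos
    linarith
  have ht₁T : t₁ ∈ Ioo 0 T := ⟨ht₁pos, ht₁.2.trans_lt ht.2⟩
  have hslice : ContDiff ℝ 2 (fun z => γ z t₁) := by
    rw [← contDiffOn_univ]
    exact hγ.comp (f := fun z : ℝ => (z, t₁)) (by fun_prop)
      fun z _ => ⟨mem_univ _, Ioo_subset_Icc_self ht₁T⟩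
  have htime : ∀ z, HasDerivAt (fun s => γ z s) (deriv (fun s => γ z s) t₁) t₁ := by
    intro z
    have h₁ : ContDiffAt ℝ 2 (Function.uncurry γ) (z, t₁) :=
      hγ.contDiffAt (prod_mem_nhds univ_mem (Icc_mem_nhds ht₁T.1 ht₁T.2))
    have h₂ : DifferentiableAt ℝ (fun s : ℝ => (z, s)) t₁ := by fun_prop
    exact ((h₁.differentiableAt (by norm_num)).comp t₁ h₂).hasDerivAt
  set L := lam * exp (-η * t₁) with hL
  have hLpos : 0 < L := by positivity
  have hLlam : L ≤ lam := by
    refine mul_le_of_le_one_right hlam.le (exp_le_one_iff.2 ?_)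
    have := mul_nonneg hη ht₁pos.le
    linarith
  have hδ0 := hδ.1
  have hσpos : 0 ≤ √(δ + |y₁ - x₁|) - √δ :=
    sub_nonneg.2 (Real.sqrt_le_sqrt (by linarith [abs_nonneg (y₁ - x₁)]))
  set σ := 2 * L * (√(δ + |y₁ - x₁|) - √δ) with hσ
  have hWσ : γ y₁ t₁ - γ x₁ t₁ = W x₁ y₁ t₁ + σ := by simp only [hW, hσ, hL]; ring
  have hspace := SolvesTrans.sub_le_of_doubling_max hM hψ hlip hslice
    (fun z => hrange z t₁ (Ioo_subset_Icc_self ht₁T)) (fun z => hsol z t₁ ht₁T) hLpos hδ0 hne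
    (by
      have : 0 ≤ σ := by positivity
      linarith)
    (fun x' y' => le_of_mul_le_mul_left (hmax t₁ ht₁ x' y') (exp_pos _))
  have hderiv : k * W x₁ y₁ t₁
      ≤ deriv (fun s => γ y₁ s) t₁ - deriv (fun s => γ x₁ s) t₁ + η * σ := by
    have he : ∀ c : ℝ, HasDerivAt (fun s : ℝ => exp (-c * s)) (exp (-c * t₁) * -c) t₁ := fun c =>
      by simpa using ((hasDerivAt_id t₁).const_mul (-c)).exp
    have hWd : HasDerivAt (fun s => W x₁ y₁ s)
        (deriv (fun s => γ y₁ s) t₁ - deriv (fun s => γ x₁ s) t₁ + η * σ) t₁ := by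
      refine (((htime y₁).sub (htime x₁)).sub ((((he η).const_mul lam).const_mul 2).mul_const
        (√(δ + |y₁ - x₁|) - √δ))).congr_deriv ?_
      simp only [hσ, hL]
      ring
    have h₁ := ((he k).mul hWd).nonneg_of_forall_left_le ht₁pos fun s hs =>
      hmax s ⟨hs.1, hs.2.trans ht₁.2⟩ x₁ y₁
    rw [show exp (-k * t₁) * -k * W x₁ y₁ t₁ + exp (-k * t₁) *
      (deriv (fun s => γ y₁ s) t₁ - deriv (fun s => γ x₁ s) t₁ + η * σ)
      = exp (-k * t₁) * (deriv (fun s => γ y₁ s) t₁ - deriv (fun s => γ x₁ s) t₁ + η * σ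
        - k * W x₁ y₁ t₁) by ring] at h₁
    linarith [nonneg_of_mul_nonneg_right h₁ (exp_pos _)]
  have hR : 0 < δ + |y₁ - x₁| := by positivity
  have hr : 0 < √(δ + |y₁ - x₁|) := Real.sqrt_pos.2 hR
  have hstrict := sqrt_modulus_strict_ineq (B := lam / √δ) (σ := σ) (w := W x₁ y₁ t₁) (L := L)
    (r := √(δ + |y₁ - x₁|)) (v := √(δ + |y₁ - x₁| + L ^ 2)) (η := η) hM hC hLpos hr
    (Real.sqrt_pos.2 (by positivity))
    (by rw [Real.sq_sqrt hR.le, Real.sq_sqrt (by positivity)])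
    (by
      rw [Real.sq_sqrt hR.le, hhy]
      linarith [abs_le.2 hh, Real.pi_lt_four, hδ.2])
    (hLlam.trans hlam1)
    (by
      have : 18 * C * M * L ^ 2 ≤ 18 * C * M * lam ^ 2 := by gcongr
      linarith)
    hη hηM
    (by
      refine mul_le_mul_of_nonneg_left ?_ (by positivity)
      linarith [Real.sqrt_nonneg δ])
    hWpos.le
    (div_le_div₀ hlam.le hLlam (Real.sqrt_pos.2 hδ0)
      (Real.sqrt_le_sqrt (by linarith [abs_nonneg (y₁ - x₁)])))
  rw [hWσ] at hspace
  linarith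

/-- **The a priori modulus-of-continuity estimate `Z ≤ 0`** (proof of Theorem 1, `n = 1`).
With `Γ(r) = ∫_{ρ̄}^r ds/φ(s)`, `J = Γ(I)` and `ψ = φ ∘ Γ⁻¹`, there are `λ₀, η > 0`
depending only on `I` and `φ` such that any `2π`-periodic solution `γ` of the transformed
flow whose initial datum admits the concave modulus `θ ↦ 2λ̄(√(δ+θ) - √δ)` (with
`0 < λ̄ ≤ λ₀`, `0 < δ < 1`) keeps this modulus multiplied by `e^{-ηt}` for all later times. -/
theorem transformed_flow_modulus_decay
    (a b : ℝ) (hab : a ≤ b) (I : Set ℝ) (hI : I = Icc a b)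
    (φ : ℝ → ℝ) (hφ : ContDiffOn ℝ (⊤ : ℕ∞) φ I) (hφpos : ∀ s ∈ I, 0 < φ s)
    (rb : ℝ) (hrb : rb ∈ I)
    (Γ : ℝ → ℝ) (hΓ : ∀ r, Γ r = ∫ s in rb..r, 1 / φ s)
    (J : Set ℝ) (hJ : J = Γ '' I)
    (ψ : ℝ → ℝ) (hψ : ψ = φ ∘ Function.invFunOn Γ I) :
    ∃ lam₀ η : ℝ, 0 < lam₀ ∧ 0 < η ∧
      ∀ δ ∈ Ioo (0:ℝ) 1, ∀ lamb ∈ Ioc (0:ℝ) lam₀, ∀ T : ℝ, 0 < T →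
        ∀ γ : ℝ → ℝ → ℝ,
          ContDiffOn ℝ (⊤ : ℕ∞) (Function.uncurry γ) (univ ×ˢ Icc 0 T) →
          (∀ x t, γ (x + 2 * π) t = γ x t) →
          (∀ x t, t ∈ Icc 0 T → γ x t ∈ J) →
          (∀ x t, t ∈ Ioo 0 T → SolvesTrans ψ γ x t) →
          (∀ x y : ℝ,
            |γ y 0 - γ x 0| ≤ 2 * lamb * (Real.sqrt (δ + circleDist x y) - Real.sqrt δ)) →
          ∀ x y t, t ∈ Icc 0 T →
            |γ y t - γ x t| ≤
              2 * lamb * (Real.sqrt (δ + circleDist x y) - Real.sqrt δ) *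
                Real.exp (-η * t) := by
  subst hI
  obtain ⟨hJIcc, M, C, hM, hC, hψb, hlip⟩ := exists_bounds_comp_inverse_primitive hab
    (hφ.of_le (WithTop.coe_le_coe.2 (le_top : (2 : ℕ∞) ≤ ⊤))) hφpos hrb hΓ
  rw [← hψ] at hψb hlip
  rw [hJIcc] at hJ
  subst hJ
  refine ⟨min 1 (1 / (18 * (C + 1) * M)), 1 / (108 * M), by positivity, by positivity, ?_⟩
  intro δ hδ lam hlam T hT γ hγ hper hrange hsol hinit
  have hγ2 : ContDiffOn ℝ 2 (Function.uncurry γ) (univ ×ˢ Icc 0 T) :=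
    hγ.of_le (WithTop.coe_le_coe.2 (le_top : (2 : ℕ∞) ≤ ⊤))
  have hlam0 := hlam.1
  have hlam1 : lam ≤ 1 := hlam.2.trans (min_le_left _ _)
  have hClam : 18 * C * M * lam ^ 2 ≤ 1 := by
    have h₁ := hlam.2.trans (min_le_right _ _)
    rw [le_div_iff₀ (by positivity)] at h₁
    have h₂ : lam ^ 2 ≤ lam := by nlinarith
    calc 18 * C * M * lam ^ 2 ≤ 18 * C * M * lam := by gcongr
      _ ≤ lam * (18 * (C + 1) * M) := by nlinarith [mul_pos hM hlam0]
      _ ≤ 1 := h₁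
  have hdist : ∀ x y : ℝ, ∃ j : ℤ, circleDist x y = |x - y + 2 * π * j| := by
    intro x y
    obtain ⟨j, -, hj⟩ := exists_int_abs_add_two_pi_mul_le (x - y)
    exact ⟨j, le_antisymm (ciInf_le ⟨0, by rintro _ ⟨k, rfl⟩; positivity⟩ j) (le_ciInf hj)⟩
  have hdist_le : ∀ x y : ℝ, circleDist x y ≤ |y - x| := by
    intro x y
    have : circleDist x y ≤ |x - y + 2 * π * (0 : ℤ)| :=
      ciInf_le (f := fun j : ℤ => |x - y + 2 * π * j|)
        ⟨0, by rintro _ ⟨k, rfl⟩; positivity⟩ 0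
    simpa [abs_sub_comm] using this
  have hline : ∀ t ∈ Ico 0 T, ∀ x y, γ y t - γ x t
      ≤ 2 * (lam * exp (-(1 / (108 * M)) * t)) * (√(δ + |y - x|) - √δ) := by
    intro t ht x y
    refine sub_le_sqrt_modulus_mul_exp hM hC hψb hlip hδ hlam0 hlam1 hClam (by positivity)
      (by field_simp; norm_num) hγ2 hper hrange hsol (fun x y => ?_) ht x y
    refine (le_abs_self _).trans ((hinit x y).trans ?_)
    have := hdist_le x y
    gcongr
  have hcircle : ∀ x y, ∀ t ∈ Ico 0 T, |γ y t - γ x t|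
      ≤ 2 * lam * (√(δ + circleDist x y) - √δ) * exp (-(1 / (108 * M)) * t) := by
    intro x y t ht
    obtain ⟨j, hj⟩ := hdist x y
    have hshift : γ (x + j * (2 * π)) t = γ x t :=
      Function.Periodic.int_mul (f := fun z => γ z t) (fun z => hper z t) j x
    have h₁ := hline t ht (x + j * (2 * π)) y
    have h₂ := hline t ht y (x + j * (2 * π))
    rw [hshift, show |y - (x + j * (2 * π))| = circleDist x y by
      rw [hj, ← abs_neg]; congr 1; ring] at h₁
    rw [hshift, show |x + j * (2 * π) - y| = circleDist x y by
      rw [hj]; congr 1; ring] at h₂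
    rw [abs_le]
    constructor <;> linarith
  intro x y t ht
  have hcl : closure (Ico 0 T) = Icc 0 T := closure_Ico hT.ne
  have hc : ∀ z, ContinuousOn (fun s => γ z s) (Icc 0 T) := fun z =>
    hγ.continuousOn.comp (f := fun s : ℝ => (z, s)) (by fun_prop) fun s hs => ⟨mem_univ _, hs⟩
  refine le_on_closure (f := fun t => |γ y t - γ x t|) (hcircle x y) ?_ ?_ (hcl ▸ ht)
  · rw [hcl]
    exact ((hc y).sub (hc x)).abs
  · fun_prop
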